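/- Let H be an integer (n+m)×n matrix of rank n in the form (1): its top n×n block H_B is lower triangular HNF whose first s diagonal entries equal 1 and whose remaining k = n − s diagonal entries are at least 2, and let Δ = Δ_n(H). If n > Δ·(2Δ + 1)^m + log₂ Δ, then there exist indices 1 ≤ i < j ≤ s such that the vector v = H(e_i − e_j) has exactly two nonzero coordinates, one equal to 1 and the other equal to −1; in particular the lattice Λ(H) = {H t : t ∈ ℤⁿ} contains a nonzero vector v with ‖v‖_∞ = 1 (and hence ‖v‖_p = 2^{1/p} for every finite p ≥ 1). -/

import Mathlib

open Matrix

/-- `maxAbsSubdet k H` is `Δ_k(H)`: the maximum absolute value of the determinants of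
all `k × k` submatrices of `H`. -/
def maxAbsSubdet {d n : ℕ} (k : ℕ) (H : Matrix (Fin d) (Fin n) ℤ) : ℕ :=
  Finset.univ.sup fun p : (Fin k → Fin d) × (Fin k → Fin n) =>
    (H.submatrix p.1 p.2).det.natAbs

theorem natAbs_det_submatrix_le_maxAbsSubdet {d n k : ℕ} (H : Matrix (Fin d) (Fin n) ℤ)
    (r : Fin k → Fin d) (c : Fin k → Fin n) :
    (H.submatrix r c).det.natAbs ≤ maxAbsSubdet k H :=
  Finset.le_sup (f := fun p : (Fin k → Fin d) × (Fin k → Fin n) =>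
    (H.submatrix p.1 p.2).det.natAbs) (Finset.mem_univ (r, c))

theorem abs_cramer_transpose_le_maxAbsSubdet {d n : ℕ} (H : Matrix (Fin d) (Fin n) ℤ)
    (r : Fin n → Fin d) (l : Fin d) (j : Fin n) :
    |cramer (H.submatrix r id)ᵀ (H l) j| ≤ maxAbsSubdet n H := by
  have hrow : (H.submatrix r id).updateRow j (H l) =
      H.submatrix (Function.update r j l) id := by
    ext a b
    by_cases h : a = j
    · subst h; simp
    · simp [h]
  rw [cramer_transpose_apply, hrow, Int.abs_eq_natAbs]
  exact_mod_cast natAbs_det_submatrix_le_maxAbsSubdet H _ id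

/-- If columns `i` and `j` of `A` differ by `e_i - e_j`, then equality of the corresponding
Cramer coordinates of `b` forces `b i = b j`. -/
theorem apply_eq_of_cramer_transpose_eq {n : ℕ} {A : Matrix (Fin n) (Fin n) ℤ} (hA : A.det ≠ 0)
    {i j : Fin n} (hcol : A *ᵥ (Pi.single i 1 - Pi.single j 1) = Pi.single i 1 - Pi.single j 1)
    (b : Fin n → ℤ) (hb : cramer Aᵀ b i = cramer Aᵀ b j) : b i = b j := by
  have key : A.det • b = cramer Aᵀ b ᵥ* A := by
    rw [← mulVec_transpose, mulVec_cramer, det_transpose]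
  have h := congrArg (fun w => w ⬝ᵥ (Pi.single i 1 - Pi.single j 1)) key
  simp only [← dotProduct_mulVec, hcol] at h
  simp only [dotProduct_sub, dotProduct_single_one, hb, sub_self, Pi.smul_apply,
    smul_eq_mul, ← mul_sub, mul_eq_zero, hA, false_or] at h
  exact sub_eq_zero.mp h

theorem two_pow_le_prod {n s : ℕ} (hs : s ≤ n) (d : Fin n → ℤ) (hpos : ∀ i, 0 < d i)
    (htwo : ∀ i : Fin n, s ≤ (i : ℕ) → 2 ≤ d i) : 2 ^ (n - s) ≤ ∏ i, d i := by
  obtain ⟨k, rfl⟩ := Nat.exists_eq_add_of_le hs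
  rw [Fin.prod_univ_add, Nat.add_sub_cancel_left]
  have h1 : (1 : ℤ) ≤ ∏ i : Fin s, d (Fin.castAdd k i) :=
    Finset.prod_pos fun i _ => hpos _
  have h2 : (2 : ℤ) ^ k ≤ ∏ i : Fin k, d (Fin.natAdd s i) := by
    simpa using Finset.prod_le_prod (s := Finset.univ) (f := fun _ : Fin k => (2 : ℤ))
      (fun _ _ => by norm_num) (fun i _ => htwo (Fin.natAdd s i) (by simp))
  nlinarith [pow_pos (show (0 : ℤ) < 2 by norm_num) k]

/-- Among the first `s` columns of a matrix in Hermite normal form with unit diagonal there, two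
agree in all rows outside the identity block. -/
theorem exists_ne_columns_eq (n m s : ℕ) (hs : s ≤ n)
    (H : Matrix (Fin (n + m)) (Fin n) ℤ)
    (HB : Matrix (Fin n) (Fin n) ℤ) (hHB : HB = H.submatrix (Fin.castAdd m) id)
    (htri : ∀ i j : Fin n, i < j → HB i j = 0)
    (hpos : ∀ i : Fin n, 0 < HB i i)
    (hred : ∀ i j : Fin n, j < i → 0 ≤ HB i j ∧ HB i j < HB i i)
    (hone : ∀ i j : Fin n, (i : ℕ) < s → HB i j = (1 : Matrix (Fin n) (Fin n) ℤ) i j)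
    (htwo : ∀ i : Fin n, s ≤ (i : ℕ) → 2 ≤ HB i i)
    (Δ : ℕ) (hΔ : Δ = maxAbsSubdet n H)
    (hn : (n : ℝ) > (Δ : ℝ) * (2 * (Δ : ℝ) + 1) ^ m + Real.logb 2 Δ) :
    ∃ i j : Fin n, i ≠ j ∧ (i : ℕ) < s ∧ (j : ℕ) < s ∧
      (∀ l : Fin n, s ≤ (l : ℕ) → HB l i = HB l j) ∧
      ∀ l : Fin m, H (Fin.natAdd n l) i = H (Fin.natAdd n l) j := by
  have hdet : HB.det = ∏ i, HB i i := det_of_isLowerTriangular (M := HB) fun i j h => htri i j h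
  have hdet_pos : 0 < HB.det := hdet ▸ Finset.prod_pos fun i _ => hpos i
  have hdet_le : HB.det ≤ Δ := by
    have := natAbs_det_submatrix_le_maxAbsSubdet H (Fin.castAdd m) id
    rw [← hHB, ← hΔ] at this
    lia
  have hΔpos : 0 < Δ := by lia
  have hpow : 2 ^ (n - s) ≤ Δ := by
    have := two_pow_le_prod hs (fun i => HB i i) hpos htwo
    exact_mod_cast this.trans (hdet ▸ hdet_le)
  have hlog : ((n - s : ℕ) : ℝ) ≤ Real.logb 2 Δ := by
    rw [Real.le_logb_iff_rpow_le (by norm_num) (by exact_mod_cast hΔpos), Real.rpow_natCast]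
    exact_mod_cast hpow
  have hcard : Δ * (2 * Δ + 1) ^ m < s := by
    rw [Nat.cast_sub hs] at hlog
    have : (Δ : ℝ) * (2 * (Δ : ℝ) + 1) ^ m < s := by linarith
    exact_mod_cast this
  let S : Finset (Fin n) := Finset.univ.filter fun i => (i : ℕ) < s
  let T : Finset ((Fin n → ℤ) × (Fin m → ℤ)) :=
    (Fintype.piFinset fun i => Finset.Ico 0 (HB i i)) ×ˢ
      (Fintype.piFinset fun _ => Finset.Icc (-(Δ : ℤ)) Δ)
  let f : Fin n → (Fin n → ℤ) × (Fin m → ℤ) := fun j =>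
    (fun i => if (i : ℕ) < s then 0 else HB i j,
      fun l => cramer HBᵀ (H (Fin.natAdd n l)) j)
  have hS : S.card = s := by
    simp [S, Fin.card_filter_val_lt, hs]
  have hT : T.card ≤ Δ * (2 * Δ + 1) ^ m := by
    have h1 : ∏ i, (HB i i).toNat ≤ Δ := by
      zify
      rw [Finset.prod_congr rfl fun i _ => Int.toNat_of_nonneg (hpos i).le, ← hdet]
      exact hdet_le
    have h2 : ((Δ : ℤ) + 1 + Δ).toNat = 2 * Δ + 1 := by lia
    simp only [T, Finset.card_product, Fintype.card_piFinset, Int.card_Ico, Int.card_Icc,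
      sub_zero, sub_neg_eq_add, h2, Finset.prod_const, Finset.card_univ, Fintype.card_fin]
    gcongr
  have hmaps : Set.MapsTo f S T := by
    intro j hj
    have hj : (j : ℕ) < s := by simpa [S] using hj
    simp only [T, f, Finset.coe_product, Set.mem_prod, Finset.mem_coe, Fintype.mem_piFinset,
      Finset.mem_Ico, Finset.mem_Icc]
    refine ⟨fun i => ?_, fun l => abs_le.mp ?_⟩
    · split_ifs with hi
      · exact ⟨le_rfl, hpos i⟩
      · exact hred i j (Fin.lt_def.mpr (by lia))
    · rw [hΔ, hHB]
      exact abs_cramer_transpose_le_maxAbsSubdet H _ _ _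
  obtain ⟨i, hi, j, hj, hij, hf⟩ :=
    Finset.exists_ne_map_eq_of_card_lt_of_maps_to (hT.trans_lt (hS ▸ hcard)) hmaps
  have hi : (i : ℕ) < s := by simpa [S] using hi
  have hj : (j : ℕ) < s := by simpa [S] using hj
  have hmid : ∀ l : Fin n, s ≤ (l : ℕ) → HB l i = HB l j := fun l hl => by
    simpa [f, hl.not_gt] using congrFun (congrArg Prod.fst hf) l
  refine ⟨i, j, hij, hi, hj, hmid, fun l => ?_⟩
  refine apply_eq_of_cramer_transpose_eq hdet_pos.ne' ?_ _ (congrFun (congrArg Prod.snd hf) l)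
  ext a
  simp only [mulVec_sub, mulVec_single_one, Pi.sub_apply, col_apply]
  by_cases ha : (a : ℕ) < s
  · simp [hone a _ ha, one_apply, Pi.single_apply]
  · have hai : a ≠ i := by rintro rfl; exact ha hi
    have haj : a ≠ j := by rintro rfl; exact ha hj
    simp [hmid a (not_lt.mp ha), hai, haj]

/-- Let `H` be an integer `(n+m) × n` matrix of rank `n` in the
Hermite-normal-form shape (1): its top `n × n` block `H_B` is lower triangular with
positive diagonal, reduced below-diagonal entries, whose first `s` diagonal entries
equal `1` and whose remaining `k = n - s` diagonal entries are at least `2`; let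
`Δ = Δ_n(H)`.  If `n > Δ * (2Δ + 1)^m + log₂ Δ`, then there exist indices `i < j`
among the first `s` columns such that the lattice vector `v = H (e_i - e_j) ∈ Λ(H)`
has exactly two nonzero coordinates, one equal to `1` and the other equal to `-1`
(in particular `v ≠ 0` and `‖v‖_∞ = 1`). -/
theorem exists_short_lattice_vector (n m s : ℕ) (hs : s ≤ n)
    (H : Matrix (Fin (n + m)) (Fin n) ℤ) (hrank : H.rank = n)
    (HB : Matrix (Fin n) (Fin n) ℤ) (hHB : HB = H.submatrix (Fin.castAdd m) id)
    (htri : ∀ i j : Fin n, i < j → HB i j = 0)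
    (hpos : ∀ i : Fin n, 0 < HB i i)
    (hred : ∀ i j : Fin n, j < i → 0 ≤ HB i j ∧ HB i j < HB i i)
    (hones : ∀ i : Fin n, (i : ℕ) < s → HB i i = 1)
    (htwo : ∀ i : Fin n, s ≤ (i : ℕ) → 2 ≤ HB i i)
    (Δ : ℕ) (hΔ : Δ = maxAbsSubdet n H)
    (hn : (n : ℝ) > (Δ : ℝ) * (2 * (Δ : ℝ) + 1) ^ m + Real.logb 2 Δ) :
    ∃ i j : Fin n, i < j ∧ (j : ℕ) < s ∧
      ∃ a b : Fin (n + m), a ≠ b ∧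
        H.mulVec (Pi.single i 1 - Pi.single j 1) a = 1 ∧
        H.mulVec (Pi.single i 1 - Pi.single j 1) b = -1 ∧
        ∀ l : Fin (n + m), l ≠ a → l ≠ b →
          H.mulVec (Pi.single i 1 - Pi.single j 1) l = 0 := by
  have hone : ∀ i j : Fin n, (i : ℕ) < s → HB i j = (1 : Matrix (Fin n) (Fin n) ℤ) i j := by
    intro i j hi
    rcases lt_trichotomy i j with h | rfl | h
    · rw [htri i j h, one_apply_ne h.ne]
    · rw [hones i hi, one_apply_eq]
    · have := hred i j h
      rw [hones i hi] at this
      rw [one_apply_ne h.ne']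
      lia
  obtain ⟨i, j, hij, hi, hj, hmid, hbot⟩ :=
    exists_ne_columns_eq n m s hs H HB hHB htri hpos hred hone htwo Δ hΔ hn
  wlog hlt : i < j generalizing i j
  · exact this j i hij.symm hj hi (fun l hl => (hmid l hl).symm) (fun l => (hbot l).symm)
      (lt_of_le_of_ne (not_lt.mp hlt) hij.symm)
  have htop : ∀ a b, H (Fin.castAdd m a) b = HB a b := fun a b => by rw [hHB]; rfl
  refine ⟨i, j, hlt, hj, Fin.castAdd m i, Fin.castAdd m j, by simpa using hij, ?_, ?_, ?_⟩
  · simp [mulVec_sub, htop, hone _ _ hi, hij]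
  · simp [mulVec_sub, htop, hone _ _ hj, hij.symm]
  · intro l hli hlj
    simp only [mulVec_sub, mulVec_single_one, Pi.sub_apply, col_apply]
    induction l using Fin.addCases with
    | left l =>
      have hli : l ≠ i := by rintro rfl; exact hli rfl
      have hlj : l ≠ j := by rintro rfl; exact hlj rfl
      rw [htop, htop]
      by_cases hl : (l : ℕ) < s
      · simp [hone _ _ hl, hli, hlj]
      · simp [hmid l (not_lt.mp hl)]
    | right l => simp [hbot l]
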